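/- Let n be a natural number and let S : ℝ → Matrix(n,n,ℂ), v : ℝ → ℂⁿ and φ : ℝ → ℝ be differentiable functions such that for every k ∈ ℝ: S(k) is unitary, star v(k) ⬝ᵥ v(k) = 1, S(k).mulVec v(k) = e^{iφ(k)} • v(k), and the matrix (-i) • (S(k)ᴴ * S'(k)) is positive semidefinite. Then φ'(k) ≥ 0 for every k ∈ ℝ; that is, the eigenvalue phase of S(k) is nondecreasing in k (the eigenvalues of S(k) move counterclockwise on the unit circle). -/

import Mathlib

open scoped Matrix ComplexOrder

/-- Product rule for a matrix-vector product with entrywise derivatives. -/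
theorem hasDerivAt_mulVec_apply {m n : Type*} [Fintype n] {A : ℝ → Matrix m n ℂ}
    {A' : Matrix m n ℂ} {v : ℝ → n → ℂ} {v' : n → ℂ} {k : ℝ}
    (hA : ∀ i j, HasDerivAt (fun k => A k i j) (A' i j) k)
    (hv : ∀ i, HasDerivAt (fun k => v k i) (v' i) k) (i : m) :
    HasDerivAt (fun k => (A k).mulVec (v k) i)
      ((A'.mulVec (v k) + (A k).mulVec v') i) k := by
  simp only [Matrix.mulVec, dotProduct, Pi.add_apply, ← Finset.sum_add_distrib]
  exact HasDerivAt.fun_sum fun j _ => (hA i j).mul (hv j)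

/-- Differentiating the eigenvalue equation `A v = e^{iφ} v`. -/
theorem mulVec_add_mulVec_eq_of_eigenphase {n : Type*} [Fintype n] {A : ℝ → Matrix n n ℂ}
    {A' : Matrix n n ℂ} {v : ℝ → n → ℂ} {v' : n → ℂ} {φ : ℝ → ℝ} {φ' k : ℝ}
    (hA : ∀ i j, HasDerivAt (fun k => A k i j) (A' i j) k)
    (hv : ∀ i, HasDerivAt (fun k => v k i) (v' i) k) (hφ : HasDerivAt φ φ' k)
    (heig : ∀ k, (A k).mulVec (v k) = Complex.exp (Complex.I * φ k) • v k) :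
    A'.mulVec (v k) + (A k).mulVec v' =
      Complex.exp (Complex.I * φ k) • ((Complex.I * φ') • v k + v') := by
  ext i
  have hexp : HasDerivAt (fun k => Complex.exp (Complex.I * φ k))
      (Complex.exp (Complex.I * φ k) * (Complex.I * φ')) k :=
    (hφ.ofReal_comp.const_mul Complex.I).cexp
  have hleft := hasDerivAt_mulVec_apply hA hv i
  simp only [heig] at hleft
  refine (hleft.unique (hexp.mul (hv i))).trans ?_
  simp only [Pi.smul_apply, Pi.add_apply, smul_eq_mul]
  ring

/-- Let `S : ℝ → Matrix (Fin n) (Fin n) ℂ`, `v : ℝ → ℂⁿ`,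
`φ : ℝ → ℝ` be differentiable (entrywise, with derivatives `S'`, `v'`, `φ'`) such that
for every `k`: `S k` is unitary, `star (v k) ⬝ᵥ v k = 1`,
`S k * v k = e^{i φ k} • v k`, and `(-i) • ((S k)ᴴ * S' k)` is positive semidefinite.
Then `φ' k ≥ 0` for every `k`: the eigenvalue phases of `S k` move counterclockwise. -/
theorem eigenphase_nondecreasing (n : ℕ)
    (S S' : ℝ → Matrix (Fin n) (Fin n) ℂ) (v v' : ℝ → (Fin n → ℂ))
    (φ φ' : ℝ → ℝ)
    (hS : ∀ i j k, HasDerivAt (fun k => S k i j) (S' k i j) k)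
    (hv : ∀ i k, HasDerivAt (fun k => v k i) (v' k i) k)
    (hφ : ∀ k, HasDerivAt φ (φ' k) k)
    (hunit : ∀ k, S k ∈ Matrix.unitaryGroup (Fin n) ℂ)
    (hnorm : ∀ k, star (v k) ⬝ᵥ v k = 1)
    (heig : ∀ k, (S k).mulVec (v k) = Complex.exp (Complex.I * φ k) • v k)
    (hpos : ∀ k, ((-Complex.I) • ((S k)ᴴ * S' k)).PosSemidef) :
    ∀ k, 0 ≤ φ' k := by
  intro k
  set e := Complex.exp (Complex.I * φ k) with he
  have hderiv : (S' k).mulVec (v k) + (S k).mulVec (v' k) =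
      e • ((Complex.I * φ' k) • v k + v' k) :=
    mulVec_add_mulVec_eq_of_eigenphase (fun i j => hS i j k) (fun i => hv i k) (hφ k) heig
  have he_norm : star e * e = 1 := by
    rw [Complex.star_def, he, ← Complex.exp_conj, ← Complex.exp_add]
    simp
  have hSS : (S k)ᴴ * S k = 1 := Matrix.mem_unitaryGroup_iff'.mp (hunit k)
  have hadj (w : Fin n → ℂ) :
      star (v k) ⬝ᵥ (S k)ᴴ.mulVec w = star e * (star (v k) ⬝ᵥ w) := by
    rw [Matrix.dotProduct_mulVec, ← Matrix.star_mulVec, heig, star_smul, smul_dotProduct,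
      smul_eq_mul]
  have hquad : star (v k) ⬝ᵥ ((S k)ᴴ * S' k).mulVec (v k) = Complex.I * φ' k := by
    have h := congrArg (fun w => star (v k) ⬝ᵥ (S k)ᴴ.mulVec w) hderiv
    simp only [Matrix.mulVec_add, Matrix.mulVec_mulVec, hSS, Matrix.one_mulVec,
      dotProduct_add] at h
    rw [hadj, dotProduct_smul, dotProduct_add, dotProduct_smul, hnorm] at h
    simp only [smul_eq_mul] at h
    linear_combination h + (Complex.I * φ' k + star (v k) ⬝ᵥ v' k) * he_norm
  have h := (hpos k).dotProduct_mulVec_nonneg (v k)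
  rw [Matrix.smul_mulVec, dotProduct_smul, hquad, smul_eq_mul, neg_mul, ← mul_assoc,
    Complex.I_mul_I, neg_one_mul, neg_neg] at h
  exact_mod_cast h
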